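/- Let L be the tree on vertices v_1, v_2, v_3, v_4, v_5, w where v_1 v_2 v_3 v_4 v_5 is a path and w is adjacent to v_3. Then: (a) there is no (1,2,2)-packing coloring c of L with {c(v_1), c(v_5)} = {2, 3}, i.e., v_1 and v_5 never receive distinct colors from the two 2-packing classes; and (b) there exists a (1,2,2)-packing coloring of L in which c(v_1) = c(v_5) = 2. -/

import Mathlib

/-- `c` is an `s`-packing coloring of the simple graph `G`: for each color `i`, any two
distinct vertices with color `i` are at graph distance strictly greater than `s i`
(vertices in different connected components trivially satisfy this). -/
def IsPackingColoring {V : Type*} (G : SimpleGraph V) {k : ℕ} (s : Fin k → ℕ)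
    (c : V → Fin k) : Prop :=
  ∀ u v : V, u ≠ v → c u = c v → G.Reachable u v → s (c u) < G.dist u v

/-- The tree `L`: a path `v₁ v₂ v₃ v₄ v₅` (vertices `0,…,4`) with a vertex `w = 5`
adjacent to `v₃ = 2`. -/
def treeL : SimpleGraph (Fin 6) :=
  SimpleGraph.fromRel (fun u v =>
    (u, v) ∈ ([(0,1),(1,2),(2,3),(3,4),(2,5)] : List (Fin 6 × Fin 6)))

instance : DecidableRel treeL.Adj := by
  unfold treeL
  infer_instance

theorem SimpleGraph.Walk.adj_or_exists_common_neighbor {V : Type*} {G : SimpleGraph V} {u v : V}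
    (p : G.Walk u v) (huv : u ≠ v) (hp : p.length ≤ 2) :
    G.Adj u v ∨ (p.length = 2 ∧ ∃ w, G.Adj u w ∧ G.Adj w v) := by
  match p with
  | .nil => exact absurd rfl huv
  | .cons h .nil => exact Or.inl h
  | .cons h (.cons h' .nil) => exact Or.inr ⟨rfl, _, h, h'⟩
  | .cons _ (.cons _ (.cons _ _)) => simp at hp

/-- A `(1,2,2)`-packing coloring is a proper coloring in which vertices of color `1` or `2`
sharing a neighbor receive distinct colors. -/
theorem isPackingColoring_one_two_two_iff {V : Type*} {G : SimpleGraph V} {c : V → Fin 3} :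
    IsPackingColoring G ![1, 2, 2] c ↔
      ∀ u v, u ≠ v → c u = c v →
        ¬ G.Adj u v ∧ (c u ≠ 0 → ∀ w, ¬ (G.Adj u w ∧ G.Adj w v)) := by
  have hs_pos : ∀ i : Fin 3, 1 ≤ (![1, 2, 2] : Fin 3 → ℕ) i := by decide
  have hs_le : ∀ i : Fin 3, (![1, 2, 2] : Fin 3 → ℕ) i ≤ 2 := by decide
  have hs_two : ∀ i : Fin 3, (![1, 2, 2] : Fin 3 → ℕ) i = 2 ↔ i ≠ 0 := by decide
  constructor
  · intro hc u v huv hcol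
    refine ⟨fun hadj => ?_, fun h0 w ⟨huw, hwv⟩ => ?_⟩
    · have hlt := hc u v huv hcol hadj.reachable
      have hdist := SimpleGraph.dist_eq_one_iff_adj.mpr hadj
      have := hs_pos (c u)
      omega
    · have hlt := hc u v huv hcol (huw.reachable.trans hwv.reachable)
      have hdist : G.dist u v ≤ 2 :=
        SimpleGraph.dist_le (.cons huw (.cons hwv .nil))
      have := (hs_two (c u)).mpr h0
      omega
  · intro h u v huv hcol hreach
    obtain ⟨hadj, hcommon⟩ := h u v huv hcol
    obtain ⟨p, hp⟩ := hreach.exists_walk_length_eq_dist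
    by_contra! hle
    have := hs_le (c u)
    rcases p.adj_or_exists_common_neighbor huv (by omega) with huv' | ⟨hlen, w, hw⟩
    · exact hadj huv'
    · exact hcommon ((hs_two (c u)).mp (by omega)) w hw

/-- In a `(1,2,2)`-packing coloring (colors `0, 1, 2` where `1` and `2` are the two
`2`-packing classes): (a) `v₁` and `v₅` never receive distinct colors from `{1, 2}`;
(b) there is a coloring where `v₁` and `v₅` both receive color `1`. -/
theorem treeL_transmitter :
    (¬ ∃ c : Fin 6 → Fin 3, IsPackingColoring treeL ![1, 2, 2] c ∧
        ((c 0 = 1 ∧ c 4 = 2) ∨ (c 0 = 2 ∧ c 4 = 1))) ∧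
    (∃ c : Fin 6 → Fin 3, IsPackingColoring treeL ![1, 2, 2] c ∧ c 0 = 1 ∧ c 4 = 1) := by
  simp only [isPackingColoring_one_two_two_iff]
  refine ⟨?_, ![1, 0, 2, 0, 1, 0], by decide, rfl, rfl⟩
  rintro ⟨c, hc, hends⟩
  have hadj : ∀ u v, treeL.Adj u v → c u ≠ c v := fun u v huv hcol =>
    (hc u v huv.ne hcol).1 huv
  have hcommon : ∀ u v w, u ≠ v → treeL.Adj u w → treeL.Adj w v → c u = c v → c u = 0 := by
    intro u v w huv huw hwv hcol
    by_contra h0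
    exact (hc u v huv hcol).2 h0 w ⟨huw, hwv⟩
  have h01 := hadj 0 1 (by decide)
  have h12 := hadj 1 2 (by decide)
  have h23 := hadj 2 3 (by decide)
  have h34 := hadj 3 4 (by decide)
  have h25 := hadj 2 5 (by decide)
  have h02 := hcommon 0 2 1 (by decide) (by decide) (by decide)
  have h24 := hcommon 4 2 3 (by decide) (by decide) (by decide)
  have h15 := hcommon 1 5 2 (by decide) (by decide) (by decide)
  have h35 := hcommon 3 5 2 (by decide) (by decide) (by decide)
  omega
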